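/- arXiv:1003.1421 — 5 statements merged into one kernel-verified Lean document; each statement's English description precedes it below -/
import Mathlib

section
/- Let A be a commutative ring and let Λ be an Azumaya algebra over A, where A is equipped with a derivation δ : A → A. Then δ extends to Λ: there exists an additive map D : Λ → Λ satisfying the Leibniz rule D(xy) = D(x)y + xD(y) for all x, y ∈ Λ and D(a·1_Λ) = δ(a)·1_Λ for all a ∈ A. -/
open TensorProduct

/-- The canonical map `Λ ⊗[A] Λᵐᵒᵖ →ₗ[A] End_A(Λ)`, sending `a ⊗ bᵒᵖ` to `x ↦ a * x * b`.
An A-algebra `Λ` (finitely generated, faithful and projective as an A-module) is Azumaya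
when this map is bijective. -/
noncomputable def azumayaMulMap (A : Type*) (Λ : Type*) [CommRing A] [Ring Λ] [Algebra A Λ] :
    Λ ⊗[A] Λᵐᵒᵖ →ₗ[A] (Λ →ₗ[A] Λ) :=
  TensorProduct.lift <|
    LinearMap.mk₂ A
      (fun a b => (LinearMap.mulLeft A a).comp (LinearMap.mulRight A b.unop))
      (fun a a' b => by ext x; simp [add_mul, mul_add])
      (fun c a b => by ext x; simp [smul_mul_assoc])
      (fun a b b' => by ext x; simp [mul_add])
      (fun c a b => by ext x; simp [mul_smul_comm])

/-- A finite projective faithful algebra over a commutative ring `A` admits an `A`-linear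
functional sending `1` to `1`. -/
theorem exists_dual_map_one_eq_one (A Λ : Type*) [CommRing A] [Ring Λ] [Algebra A Λ]
    [Module.Finite A Λ] [Module.Projective A Λ] [FaithfulSMul A Λ] :
    ∃ l : Λ →ₗ[A] A, l 1 = 1 := by
  obtain ⟨n, p, s, -, -, hps⟩ := Module.Finite.exists_comp_eq_id_of_projective A Λ
  let I : Ideal A := LinearMap.range (LinearMap.applyₗ (1 : Λ) : (Λ →ₗ[A] A) →ₗ[A] A)
  have hone : (1 : Λ) = ∑ i, s 1 i • p (Pi.single i 1) := by
    conv_lhs => rw [← LinearMap.id_apply (R := A) (1 : Λ), ← hps, LinearMap.comp_apply,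
      pi_eq_sum_univ' (s 1), map_sum]
    refine Finset.sum_congr rfl fun i _ => ?_
    rw [map_smul]
  have hI : (⊤ : Submodule A Λ) ≤ I • ⊤ := by
    intro x _
    rw [← mul_one x, hone, Finset.mul_sum]
    refine Submodule.sum_mem _ fun i _ => ?_
    rw [mul_smul_comm]
    exact Submodule.smul_mem_smul ⟨(LinearMap.proj i).comp s, rfl⟩ trivial
  obtain ⟨r, hr, hr0⟩ := Submodule.exists_sub_one_mem_and_smul_eq_zero_of_fg_of_le_smul
    I ⊤ Module.Finite.fg_top hI
  obtain rfl : r = 0 := FaithfulSMul.eq_of_smul_eq_smul (α := Λ) fun x => by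
    rw [hr0 x trivial, zero_smul]
  obtain ⟨l, hl⟩ := hr
  refine ⟨-l, ?_⟩
  have hl' : l 1 = 0 - 1 := hl
  simp [hl']

theorem azumayaMulMap_tmul {A Λ : Type*} [CommRing A] [Ring Λ] [Algebra A Λ]
    (a : Λ) (b : Λᵐᵒᵖ) (x : Λ) : azumayaMulMap A Λ (a ⊗ₜ b) x = a * (x * b.unop) := rfl

/-- An Azumaya algebra has a separability idempotent. -/
theorem exists_separability_idempotent {A Λ : Type*} [CommRing A] [Ring Λ] [Algebra A Λ]
    [Module.Finite A Λ] [Module.Projective A Λ] [FaithfulSMul A Λ]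
    (hAz : Function.Bijective (azumayaMulMap A Λ)) :
    ∃ S : Finset (Λ × Λᵐᵒᵖ), ∑ i ∈ S, i.1 * i.2.unop = 1 ∧
      ∀ b : Λ, ∑ i ∈ S, (b * i.1) ⊗ₜ[A] i.2 =
        ∑ i ∈ S, i.1 ⊗ₜ[A] MulOpposite.op (i.2.unop * b) := by
  obtain ⟨l, hl⟩ := exists_dual_map_one_eq_one A Λ
  obtain ⟨e, he⟩ := hAz.2 ((Algebra.linearMap A Λ).comp l)
  obtain ⟨S, rfl⟩ := TensorProduct.exists_finset e
  have key (x : Λ) : ∑ i ∈ S, i.1 * (x * i.2.unop) = algebraMap A Λ (l x) := by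
    simpa [azumayaMulMap_tmul] using LinearMap.congr_fun he x
  refine ⟨S, by simpa [hl] using key 1, fun b => hAz.1 (LinearMap.ext fun x => ?_)⟩
  simp only [map_sum, LinearMap.sum_apply, azumayaMulMap_tmul, MulOpposite.unop_op]
  calc ∑ i ∈ S, b * i.1 * (x * i.2.unop) = b * algebraMap A Λ (l x) := by
        simp only [← key x, Finset.mul_sum, mul_assoc]
    _ = algebraMap A Λ (l x) * b := (Algebra.commutes _ _).symm
    _ = ∑ i ∈ S, i.1 * (x * (i.2.unop * b)) := by
        simp only [← key x, Finset.sum_mul, mul_assoc]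

/-- Every Hochschild 2-cocycle of an algebra with a separability idempotent is a coboundary. -/
theorem exists_eq_coboundary_of_cocycle {A Λ : Type*} [CommRing A] [Ring Λ] [Algebra A Λ]
    (S : Finset (Λ × Λᵐᵒᵖ)) (hS : ∑ i ∈ S, i.1 * i.2.unop = 1)
    (hcomm : ∀ b : Λ, ∑ i ∈ S, (b * i.1) ⊗ₜ[A] i.2 =
      ∑ i ∈ S, i.1 ⊗ₜ[A] MulOpposite.op (i.2.unop * b))
    (c : Λ →ₗ[A] Λ →ₗ[A] Λ)
    (hc : ∀ x y z, x * c y z - c (x * y) z + c x (y * z) - c x y * z = 0) :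
    ∃ h : Λ →ₗ[A] Λ, ∀ x y, c x y = x * h y - h (x * y) + h x * y := by
  refine ⟨∑ i ∈ S, (LinearMap.mulRight A i.2.unop).comp (c.flip i.1), fun x y => ?_⟩
  simp only [LinearMap.sum_apply, LinearMap.comp_apply, LinearMap.flip_apply,
    LinearMap.mulRight_apply]
  have hflip : ∑ i ∈ S, c x (y * i.1) * i.2.unop = ∑ i ∈ S, c x i.1 * (i.2.unop * y) := by
    simpa using congrArg (TensorProduct.lift ((LinearMap.mul A Λ).compl₁₂ (c x)
      (MulOpposite.opLinearEquiv A : Λ ≃ₗ[A] Λᵐᵒᵖ).symm.toLinearMap)) (hcomm y)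
  have hsum : ∑ i ∈ S, (x * c y i.1 - c (x * y) i.1 + c x (y * i.1) - c x y * i.1) * i.2.unop
      = 0 := by simp [hc]
  simp only [sub_mul, add_mul, Finset.sum_sub_distrib, Finset.sum_add_distrib, hflip,
    mul_assoc (c x y), ← Finset.mul_sum, hS, mul_one] at hsum
  simp only [mul_assoc, ← Finset.mul_sum, Finset.sum_mul] at hsum ⊢
  exact (sub_eq_zero.mp hsum).symm

/-- A finite projective module over a commutative ring with a derivation `δ` admits a connection
along `δ`. -/
theorem exists_connection {A : Type*} (M : Type*) [CommRing A] [AddCommGroup M] [Module A M]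
    [Module.Finite A M] [Module.Projective A M] (δ : A → A)
    (hδadd : ∀ a b : A, δ (a + b) = δ a + δ b)
    (hδmul : ∀ a b : A, δ (a * b) = δ a * b + a * δ b) :
    ∃ N : M → M, (∀ x y, N (x + y) = N x + N y) ∧
      ∀ (a : A) (x : M), N (a • x) = δ a • x + a • N x := by
  obtain ⟨n, p, s, -, -, hps⟩ := Module.Finite.exists_comp_eq_id_of_projective A M
  refine ⟨fun x => p fun i => δ (s x i), fun x y => ?_, fun a x => ?_⟩
  · simp only [map_add, Pi.add_apply, hδadd]
    exact map_add p _ _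
  · have hx : p (s x) = x := LinearMap.congr_fun hps x
    simp only [map_smul, Pi.smul_apply, smul_eq_mul, hδmul]
    calc _ = p (δ a • s x + a • fun i => δ (s x i)) := rfl
      _ = _ := by rw [map_add, map_smul, map_smul, hx]

/-- Let `A` be a commutative ring (a ℚ-algebra) with a derivation `δ` and let
`Λ` be an Azumaya algebra over `A`.  Then `δ` extends to `Λ`: there is an additive map
`D : Λ → Λ` satisfying the Leibniz rule and `D (a • 1) = δ a • 1` for all `a ∈ A`. -/
theorem derivation_extends_to_azumaya_algebra
    {A : Type*} {Λ : Type*} [CommRing A] [Algebra ℚ A] [Ring Λ] [Algebra A Λ]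
    [Module.Finite A Λ] [Module.Projective A Λ] [FaithfulSMul A Λ]
    (hAz : Function.Bijective (azumayaMulMap A Λ))
    (δ : A → A)
    (hδadd : ∀ a b : A, δ (a + b) = δ a + δ b)
    (hδmul : ∀ a b : A, δ (a * b) = δ a * b + a * δ b) :
    ∃ D : Λ → Λ,
      (∀ x y : Λ, D (x + y) = D x + D y) ∧
      (∀ x y : Λ, D (x * y) = D x * y + x * D y) ∧
      (∀ a : A, D (algebraMap A Λ a) = algebraMap A Λ (δ a)) := by
  obtain ⟨N, hadd, hsmul⟩ := exists_connection Λ δ hδadd hδmul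
  let c : Λ →ₗ[A] Λ →ₗ[A] Λ := LinearMap.mk₂ A (fun x y => N (x * y) - N x * y - x * N y)
    (fun x x' y => by simp only [add_mul, hadd]; abel)
    (fun a x y => by
      simp only [smul_mul_assoc, hsmul, add_mul, smul_sub]; abel)
    (fun x y y' => by simp only [mul_add, hadd]; abel)
    (fun a x y => by
      simp only [mul_smul_comm, hsmul, mul_add, smul_sub]; abel)
  have hcdef (x y : Λ) : c x y = N (x * y) - N x * y - x * N y := rfl
  obtain ⟨S, hS, hcomm⟩ := exists_separability_idempotent hAz
  obtain ⟨h, hh⟩ := exists_eq_coboundary_of_cocycle S hS hcomm c fun x y z => by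
    simp only [hcdef, mul_sub, sub_mul, mul_assoc]; abel
  have hmul (x y : Λ) : N (x * y) + h (x * y) = (N x + h x) * y + x * (N y + h y) := by
    have hxy := hh x y
    rw [hcdef, sub_sub, sub_eq_iff_eq_add] at hxy
    rw [hxy, add_mul, mul_add]
    abel
  refine ⟨fun x => N x + h x, fun x y => ?_, hmul, fun a => ?_⟩
  · simp only [hadd, map_add]; abel
  · have h1 : N 1 + h 1 = 0 := by simpa using hmul 1 1
    simp only [Algebra.algebraMap_eq_smul_one, hsmul, map_smul]
    rw [add_assoc, ← smul_add, h1, smul_zero, add_zero]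
end

section
/- Let A be a commutative ring and P a faithful finitely generated projective A-module. Then every A-linear derivation of End_A(P) is inner: if D : End_A(P) → End_A(P) is an A-linear map satisfying D(f ∘ g) = D(f) ∘ g + f ∘ D(g) for all f, g ∈ End_A(P), then there exists z ∈ End_A(P) such that D(f) = z ∘ f − f ∘ z for all f ∈ End_A(P). -/
open scoped TensorProduct in
/-- The trace ideal of a faithful finitely generated projective module is the unit ideal. -/
theorem Module.Projective.contractLeft_surjective
    {A P : Type*} [CommRing A] [AddCommGroup P] [Module A P]
    [Module.Finite A P] [Module.Projective A P] [FaithfulSMul A P] :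
    Function.Surjective (contractLeft A P) := by
  have hP : (⊤ : Submodule A P) ≤ LinearMap.range (contractLeft A P) • (⊤ : Submodule A P) := by
    intro x _
    obtain ⟨s, hs⟩ := Module.Projective.out (R := A) (P := P)
    rw [← hs x, Finsupp.linearCombination_apply]
    exact Submodule.sum_mem _ fun p _ => Submodule.smul_mem_smul
      ⟨(Finsupp.lapply p ∘ₗ s) ⊗ₜ[A] x, contractLeft_apply _ _⟩ Submodule.mem_top
  obtain ⟨r, hr, hrP⟩ := Submodule.exists_sub_one_mem_and_smul_eq_zero_of_fg_of_le_smul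
    (LinearMap.range (contractLeft A P)) ⊤ Module.Finite.fg_top hP
  have hr0 : r = 0 := FaithfulSMul.eq_of_smul_eq_smul (α := P) fun x => by
    rw [hrP x Submodule.mem_top, zero_smul]
  have h1 : (1 : A) ∈ LinearMap.range (contractLeft A P) := by
    simpa [hr0] using neg_mem hr
  exact LinearMap.range_eq_top.mp ((Ideal.eq_top_iff_one _).mpr h1)

/-- Multiplying a linear derivation of `End_A(P)` by an element of the trace ideal of `P`
yields an inner derivation. -/
theorem exists_contractLeft_smul_derivation_eq_commutator
    {A P : Type*} [CommRing A] [AddCommGroup P] [Module A P]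
    (D : (P →ₗ[A] P) →ₗ[A] (P →ₗ[A] P))
    (hD : ∀ f g : P →ₗ[A] P, D (f ∘ₗ g) = D f ∘ₗ g + f ∘ₗ D g)
    (t : TensorProduct A (Module.Dual A P) P) :
    ∃ z : P →ₗ[A] P, ∀ f : P →ₗ[A] P, contractLeft A P t • D f = z ∘ₗ f - f ∘ₗ z := by
  induction t with
  | zero => exact ⟨0, fun f => by simp⟩
  | add t u ht hu =>
    obtain ⟨z, hz⟩ := ht
    obtain ⟨w, hw⟩ := hu
    refine ⟨z + w, fun f => ?_⟩
    rw [map_add, add_smul, hz, hw, LinearMap.add_comp, LinearMap.comp_add]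
    abel
  | tmul φ p =>
    refine ⟨LinearMap.applyₗ p ∘ₗ D ∘ₗ LinearMap.smulRightₗ φ, fun f => ?_⟩
    ext x
    have hf : φ.smulRight (f x) = f ∘ₗ φ.smulRight x := by
      ext y
      simp
    have h := LinearMap.congr_fun (hD f (φ.smulRight x)) p
    rw [← hf] at h
    simpa [eq_sub_iff_add_eq] using h.symm


/-- Let `A` be a commutative ring and `P` a faithful finitely generated
projective `A`-module.  Every `A`-linear derivation of `End_A(P)` (with respect to
composition) is inner: if `D` is `A`-linear and satisfies the Leibniz rule
`D (f ∘ g) = D f ∘ g + f ∘ D g`, then there is `z ∈ End_A(P)` with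
`D f = z ∘ f - f ∘ z` for all `f`. -/
theorem linear_derivation_of_end_is_inner
    {A P : Type*} [CommRing A] [AddCommGroup P] [Module A P]
    [Module.Finite A P] [Module.Projective A P] [FaithfulSMul A P]
    (D : (P →ₗ[A] P) →ₗ[A] (P →ₗ[A] P))
    (hD : ∀ f g : P →ₗ[A] P, D (f ∘ₗ g) = D f ∘ₗ g + f ∘ₗ D g) :
    ∃ z : P →ₗ[A] P, ∀ f : P →ₗ[A] P, D f = z ∘ₗ f - f ∘ₗ z := by
  obtain ⟨t, ht⟩ := Module.Projective.contractLeft_surjective (A := A) (P := P) 1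
  simpa [ht] using exists_contractLeft_smul_derivation_eq_commutator D hD t
end

section
/- Let A be a commutative ℚ-algebra equipped with a derivation δ : A → A, let n ≥ 1, and let D : Mₙ(A) → Mₙ(A) be an additive map satisfying the Leibniz rule D(xy) = D(x)y + xD(y) and D(a·1) = δ(a)·1 for all a ∈ A. Then there exists a unique matrix z ∈ Mₙ(A) with trace 0 such that D(m) = δ(m) + zm − mz for all m ∈ Mₙ(A), where δ(m) denotes the matrix obtained by applying δ to each entry of m. -/
namespace Matrix

variable {ι A : Type*} [Fintype ι] [CommRing A]

/-- The unit matrices with equal row and column index sum to the identity. -/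
theorem sum_single_same_one [DecidableEq ι] : ∑ i : ι, single i i (1 : A) = 1 := by
  ext a b
  simp only [sum_apply, single_apply, one_apply]
  rw [Finset.sum_eq_single a] <;> grind

/-- Every linear derivation of a matrix ring is inner. -/
theorem exists_eq_commutator_of_leibniz [DecidableEq ι] [Nonempty ι]
    (E : Matrix ι ι A →ₗ[A] Matrix ι ι A) (hE : ∀ x y, E (x * y) = E x * y + x * E y) :
    ∃ z : Matrix ι ι A, ∀ m, E m = z * m - m * z := by
  obtain ⟨o⟩ := ‹Nonempty ι›
  let z : Matrix ι ι A := ∑ i, E (single i o 1) * single o i 1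
  refine ⟨z, fun m => ?_⟩
  suffices h : E = LinearMap.mulLeft A z - LinearMap.mulRight A z from
    (LinearMap.congr_fun h m).trans (by simp)
  refine Matrix.ext_linearMap A fun k l => LinearMap.ext fun a => ?_
  have hl : z * single k l 1 = E (single k o 1) * single o l 1 := by
    simp only [z, Finset.sum_mul, Matrix.mul_assoc]
    rw [Finset.sum_eq_single k]
    · simp
    · intro i _ hi
      simp [single_mul_single_of_ne, hi]
    · simp
  have hr : single k l 1 * z = E (single k o 1) * single o l 1 - E (single k l 1) := by
    have hterm : ∀ i, single k l 1 * (E (single i o 1) * single o i 1) =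
        E (single k l 1 * single i o 1) * single o i 1 - E (single k l 1) * single i i 1 := by
      intro i
      rw [hE, add_mul]
      simp [Matrix.mul_assoc]
    simp only [z, Finset.mul_sum, hterm, Finset.sum_sub_distrib]
    rw [← Finset.mul_sum, sum_single_same_one, mul_one, Finset.sum_eq_single l]
    · simp
    · intro i _ hi
      simp [single_mul_single_of_ne, hi.symm]
    · simp
  have hs : single k l a = a • single k l (1 : A) := by simp
  have hu : E (single k l 1) = z * single k l 1 - single k l 1 * z := by rw [hl, hr]; abel
  simp only [LinearMap.comp_apply, singleLinearMap_apply, hs, map_smul, LinearMap.sub_apply,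
    LinearMap.mulLeft_apply, LinearMap.mulRight_apply, hu]

/-- Entrywise differentiation satisfies the Leibniz rule for matrix multiplication. -/
theorem map_mul_of_leibniz (δ : A →+ A) (hδ : ∀ a b, δ (a * b) = δ a * b + a * δ b)
    (x y : Matrix ι ι A) : (x * y).map δ = x.map δ * y + x * y.map δ := by
  ext i j
  simp [mul_apply, hδ, Finset.sum_add_distrib]

end Matrix


/-- Let `A` be a commutative ℚ-algebra with a derivation `δ`, let `n ≥ 1`
and let `D` be a derivation of the matrix ring `Mₙ(A)` extending `δ` (i.e. additive,
Leibniz, and `D (a • 1) = δ a • 1`).  Then there is a unique trace-zero matrix `z` with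
`D m = δ(m) + z * m - m * z` for all `m`, where `δ(m)` is entrywise differentiation. -/
theorem matrix_derivation_eq_entrywise_add_inner
    {A : Type*} [CommRing A] [Algebra ℚ A]
    (δ : A → A)
    (hδadd : ∀ a b : A, δ (a + b) = δ a + δ b)
    (hδmul : ∀ a b : A, δ (a * b) = δ a * b + a * δ b)
    (n : ℕ) (hn : 1 ≤ n)
    (D : Matrix (Fin n) (Fin n) A → Matrix (Fin n) (Fin n) A)
    (hDadd : ∀ x y, D (x + y) = D x + D y)
    (hDmul : ∀ x y, D (x * y) = D x * y + x * D y)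
    (hDone : ∀ a : A, D (a • (1 : Matrix (Fin n) (Fin n) A)) = δ a • 1) :
    ∃! z : Matrix (Fin n) (Fin n) A,
      Matrix.trace z = 0 ∧ ∀ m : Matrix (Fin n) (Fin n) A, D m = m.map δ + z * m - m * z := by
  have : Nonempty (Fin n) := ⟨⟨0, hn⟩⟩
  let d : A →+ A := AddMonoidHom.mk' δ hδadd
  have hD_smul : ∀ (a : A) (m : Matrix (Fin n) (Fin n) A), D (a • m) = δ a • m + a • D m := by
    intro a m
    have h := hDmul (a • 1) m
    simpa [hDone] using h
  let E : Matrix (Fin n) (Fin n) A →ₗ[A] Matrix (Fin n) (Fin n) A :=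
    { toFun := fun m => D m - m.map δ
      map_add' := fun x y => by
        rw [hDadd, Matrix.map_add δ hδadd]
        abel
      map_smul' := fun a x => by
        have h : (a • x).map δ = δ a • x + a • x.map δ := by
          ext i j
          simp [hδmul]
        rw [hD_smul, h, RingHom.id_apply, smul_sub]
        abel }
  have hE : ∀ x y, E (x * y) = E x * y + x * E y := by
    intro x y
    have h : (x * y).map δ = x.map δ * y + x * y.map δ := Matrix.map_mul_of_leibniz d hδmul x y
    change D (x * y) - (x * y).map δ = (D x - x.map δ) * y + x * (D y - y.map δ)
    rw [hDmul, h]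
    noncomm_ring
  obtain ⟨w, hw⟩ := Matrix.exists_eq_commutator_of_leibniz E hE
  have hn0 : (n : ℚ) ≠ 0 := by positivity
  have hinv : algebraMap ℚ A (n : ℚ)⁻¹ * (n : A) = 1 := by
    rw [← map_natCast (algebraMap ℚ A), ← map_mul, inv_mul_cancel₀ hn0, map_one]
  refine ⟨w - (algebraMap ℚ A (n : ℚ)⁻¹ * w.trace) • 1, ⟨?_, fun m => ?_⟩, ?_⟩
  · simp only [Matrix.trace_sub, Matrix.trace_smul, Matrix.trace_one, Fintype.card_fin, smul_eq_mul]
    linear_combination -w.trace * hinv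
  · have h : D m - m.map δ = w * m - m * w := hw m
    rw [sub_eq_iff_eq_add.mp h]
    simp only [sub_mul, mul_sub, smul_mul_assoc, mul_smul_comm, one_mul, mul_one]
    abel
  · rintro z ⟨hz, hzD⟩
    have hcomm : ∀ m, Commute m (z - w) := by
      intro m
      have h : D m - m.map δ = w * m - m * w := hw m
      rw [hzD m] at h
      have h' : z * m - m * z = w * m - m * w := by rw [← h]; abel
      rw [commute_iff_eq, mul_sub, sub_mul, ← sub_eq_zero, ← sub_eq_zero.mpr h'.symm]
      abel
    obtain ⟨c, hc⟩ := Matrix.mem_range_scalar_of_commute_single fun i j _ => hcomm _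
    have hzc : z = w + c • 1 := by
      rw [Matrix.smul_one_eq_diagonal, ← Matrix.scalar_apply, hc]
      abel
    have ht : w.trace + c * n = 0 := by
      simpa [hzc, Matrix.trace_add, Matrix.trace_smul] using hz
    have hcv : c = -(algebraMap ℚ A (n : ℚ)⁻¹ * w.trace) := by
      linear_combination algebraMap ℚ A (n : ℚ)⁻¹ * ht - c * hinv
    rw [hzc, hcv, neg_smul, sub_eq_add_neg]
end

section
/- Let (A, δ) be a differential ring, let n ≥ 1, and let M ∈ Mₙ(A). Then there exists a faithfully flat differential extension f : (A, δ) → (B, δ_B) and an invertible matrix U ∈ GLₙ(B) such that δ_B(U) = f(M)·U, where δ_B(U) denotes the matrix obtained by applying δ_B to each entry of U and f(M) is the image of M under entrywise application of f. (Concretely, B = A[T_{ij}, det(T)⁻¹] with δ_B(T) = f(M)·T works.) -/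
universe u

/-- A faithfully flat differential extension of a differential ring `(A, δ)`:
a commutative `A`-algebra `B` that is faithfully flat as an `A`-module, equipped
with a derivation `δB` extending `δ` (i.e. `δB ∘ algebraMap = algebraMap ∘ δ`). -/
structure FFDiffExt (A : Type u) [CommRing A] (δ : A → A) : Type (u + 1) where
  B : Type u
  [commRing : CommRing B]
  [algebra : Algebra A B]
  δB : B → B
  δB_add : ∀ x y : B, δB (x + y) = δB x + δB y
  δB_mul : ∀ x y : B, δB (x * y) = δB x * y + x * δB y
  compat : ∀ a : A, δB (algebraMap A B a) = algebraMap A B (δ a)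
  faithfullyFlat : Module.FaithfullyFlat A B

attribute [instance] FFDiffExt.commRing FFDiffExt.algebra


/-- The coordinate ring `A[T_{ij}, det(T)⁻¹]` of `GLₙ` over `A`. -/
abbrev GLCoordinateRing (A : Type u) [CommRing A] (n : ℕ) : Type u :=
  Localization.Away (Matrix.mvPolynomialX (Fin n) (Fin n) A).det

namespace GLCoordinateRing

variable (A : Type u) [CommRing A] (n : ℕ)

/-- The generic invertible matrix. -/
noncomputable def genericMatrix : Matrix (Fin n) (Fin n) (GLCoordinateRing A n) :=
  (Matrix.mvPolynomialX (Fin n) (Fin n) A).map (algebraMap _ _)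

theorem isUnit_det_genericMatrix : IsUnit (genericMatrix A n).det := by
  have h := IsLocalization.Away.algebraMap_isUnit (S := GLCoordinateRing A n)
    (Matrix.mvPolynomialX (Fin n) (Fin n) A).det
  rwa [RingHom.map_det] at h

variable {A n}

/-- A ring homomorphism out of `A` and an invertible matrix determine a ring homomorphism out of
the coordinate ring of `GLₙ`. -/
theorem exists_ringHom {R : Type*} [CommRing R] (f : A →+* R) (N : Matrix (Fin n) (Fin n) R)
    (hN : IsUnit N.det) :
    ∃ φ : GLCoordinateRing A n →+* R, (∀ a, φ (algebraMap A _ a) = f a) ∧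
      ∀ i j, φ (genericMatrix A n i j) = N i j := by
  let g : MvPolynomial (Fin n × Fin n) A →+* R := MvPolynomial.eval₂Hom f fun p => N p.1 p.2
  have hg : IsUnit (g (Matrix.mvPolynomialX (Fin n) (Fin n) A).det) := by
    rw [RingHom.map_det]
    convert hN
    ext i j
    simp [g]
  refine ⟨IsLocalization.Away.lift _ hg, fun a => ?_, fun i j => ?_⟩
  · rw [IsScalarTower.algebraMap_apply A (MvPolynomial (Fin n × Fin n) A),
      IsLocalization.Away.lift_eq]
    simp [g]
  · rw [genericMatrix, Matrix.map_apply, IsLocalization.Away.lift_eq]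
    simp [g]

theorem ringHom_ext {R : Type*} [CommRing R] {φ ψ : GLCoordinateRing A n →+* R}
    (hA : ∀ a, φ (algebraMap A _ a) = ψ (algebraMap A _ a))
    (hT : ∀ i j, φ (genericMatrix A n i j) = ψ (genericMatrix A n i j)) : φ = ψ := by
  refine IsLocalization.ringHom_ext
    (Submonoid.powers (Matrix.mvPolynomialX (Fin n) (Fin n) A).det) ?_
  refine MvPolynomial.ringHom_ext (fun a => ?_) fun p => ?_
  · simpa [IsScalarTower.algebraMap_apply A (MvPolynomial (Fin n × Fin n) A)
      (GLCoordinateRing A n), MvPolynomial.algebraMap_eq] using hA a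
  · simpa [genericMatrix] using hT p.1 p.2

variable (A n)

instance faithfullyFlat : Module.FaithfullyFlat A (GLCoordinateRing A n) := by
  have : Module.Flat (MvPolynomial (Fin n × Fin n) A) (GLCoordinateRing A n) :=
    IsLocalization.flat _ (Submonoid.powers (Matrix.mvPolynomialX (Fin n) (Fin n) A).det)
  have : Module.Flat A (GLCoordinateRing A n) :=
    Module.Flat.trans A (MvPolynomial (Fin n × Fin n) A) _
  obtain ⟨s, hs, -⟩ := exists_ringHom (RingHom.id A) (1 : Matrix (Fin n) (Fin n) A) (by simp)
  refine Module.FaithfullyFlat.of_comap_surjective fun p => ⟨PrimeSpectrum.comap s p, ?_⟩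
  rw [← PrimeSpectrum.comap_comp_apply]
  have : s.comp (algebraMap A (GLCoordinateRing A n)) = RingHom.id A := RingHom.ext hs
  rw [this, PrimeSpectrum.comap_id]

end GLCoordinateRing

/-- A derivation `δ : A → B` along a ring homomorphism `f : A → B` gives the ring homomorphism
`a ↦ f a + δ a ε` to the dual numbers. -/
def ringHomDualNumberOfDerivation {A : Type*} {B : Type*} [CommRing A] [CommRing B] (f : A →+* B)
    (δ : A → B) (hadd : ∀ a b, δ (a + b) = δ a + δ b)
    (hmul : ∀ a b, δ (a * b) = δ a * f b + f a * δ b) : A →+* DualNumber B where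
  toFun a := TrivSqZeroExt.inl (f a) + TrivSqZeroExt.inr (δ a)
  map_one' := by
    have h := hmul 1 1
    simp only [mul_one, map_one, one_mul, left_eq_add] at h
    simp [h]
  map_zero' := by
    have h := hadd 0 0
    simp only [add_zero, left_eq_add] at h
    simp [h]
  map_add' a b := by ext <;> simp [hadd]
  map_mul' a b := by
    ext
    · simp
    · simp [hmul, mul_comm, add_comm]

open GLCoordinateRing in
/-- A derivation of `A` extends to the coordinate ring of `GLₙ`, with any prescribed values on the
entries of the generic matrix. -/
theorem GLCoordinateRing.exists_derivation {A : Type u} [CommRing A] {n : ℕ} (δ : A → A)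
    (hadd : ∀ a b, δ (a + b) = δ a + δ b) (hmul : ∀ a b, δ (a * b) = δ a * b + a * δ b)
    (N : Matrix (Fin n) (Fin n) (GLCoordinateRing A n)) :
    ∃ D : GLCoordinateRing A n → GLCoordinateRing A n, (∀ x y, D (x + y) = D x + D y) ∧
      (∀ x y, D (x * y) = D x * y + x * D y) ∧
      (∀ a, D (algebraMap A _ a) = algebraMap A _ (δ a)) ∧
      (genericMatrix A n).map D = N := by
  let f := ringHomDualNumberOfDerivation (algebraMap A (GLCoordinateRing A n))
    (fun a => algebraMap A _ (δ a)) (by simp [hadd]) (by simp [hmul])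
  let P : Matrix (Fin n) (Fin n) (DualNumber (GLCoordinateRing A n)) :=
    Matrix.of fun i j =>
      TrivSqZeroExt.inl (genericMatrix A n i j) + TrivSqZeroExt.inr (N i j)
  let π : DualNumber (GLCoordinateRing A n) →+* GLCoordinateRing A n :=
    (TrivSqZeroExt.fstHom (GLCoordinateRing A n) (GLCoordinateRing A n)
      (GLCoordinateRing A n)).toRingHom
  have hP : IsUnit P.det := by
    rw [TrivSqZeroExt.isUnit_iff_isUnit_fst]
    change IsUnit (π P.det)
    rw [RingHom.map_det]
    convert isUnit_det_genericMatrix A n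
    ext i j
    simp [P, π]
  obtain ⟨φ, hA, hT⟩ := exists_ringHom f P hP
  have hφ : π.comp φ = RingHom.id _ := by
    refine ringHom_ext (fun a => ?_) fun i j => ?_
    · simp [hA, π, f, ringHomDualNumberOfDerivation]
    · simp [hT, π, P]
  have hfst (x : GLCoordinateRing A n) : (φ x).fst = x := DFunLike.congr_fun hφ x
  refine ⟨fun x => (φ x).snd, fun x y => by simp, fun x y => ?_, fun a => ?_, ?_⟩
  · simp [hfst, mul_comm, add_comm]
  · simp [hA, f, ringHomDualNumberOfDerivation, ← Algebra.algebraMap_eq_smul_one]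
  · ext i j
    simp [hT, P]

/-- Let `(A, δ)` be a differential ring (a ℚ-algebra), `n ≥ 1` and
`M ∈ Mₙ(A)`.  Then there is a faithfully flat differential extension `(B, δ_B)` of
`(A, δ)` and an invertible matrix `U ∈ GLₙ(B)` with `δ_B(U) = f(M) * U`, where `δ_B`
is applied entrywise and `f : A → B` is the structure map (applied entrywise to `M`). -/
theorem exists_faithfully_flat_fundamental_matrix_solution
    {A : Type u} [CommRing A] [Algebra ℚ A]
    (δ : A → A)
    (hδadd : ∀ a b : A, δ (a + b) = δ a + δ b)
    (hδmul : ∀ a b : A, δ (a * b) = δ a * b + a * δ b)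
    (n : ℕ) (hn : 1 ≤ n)
    (M : Matrix (Fin n) (Fin n) A) :
    ∃ (E : FFDiffExt A δ) (U : (Matrix (Fin n) (Fin n) E.B)ˣ),
      (U : Matrix (Fin n) (Fin n) E.B).map E.δB =
        M.map (algebraMap A E.B) * (U : Matrix (Fin n) (Fin n) E.B) := by
  obtain ⟨D, hDadd, hDmul, hDA, hDT⟩ := GLCoordinateRing.exists_derivation δ hδadd hδmul
    (M.map (algebraMap A _) * GLCoordinateRing.genericMatrix A n)
  exact ⟨⟨GLCoordinateRing A n, D, hDadd, hDmul, hDA, inferInstance⟩,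
    Matrix.nonsingInvUnit _ (GLCoordinateRing.isUnit_det_genericMatrix A n), hDT⟩
end

section
/- Let f : (A, δ_A) → (B, δ_B) be a differential ring homomorphism, let (N, d_N) be a differential B-module, and let d₁ be the additive map on N ⊗_A B determined by d₁(x ⊗ b) = d_N(x) ⊗ b + x ⊗ δ_B(b) and d₂ the additive map on B ⊗_A N determined by d₂(b ⊗ x) = δ_B(b) ⊗ x + b ⊗ d_N(x). Suppose φ : N ⊗_A B → B ⊗_A N is an additive isomorphism that is differential, i.e. φ ∘ d₁ = d₂ ∘ φ. Then the A-submodule M = { x ∈ N : φ(x ⊗ 1) = 1 ⊗ x } is closed under d_N, i.e. x ∈ M implies d_N(x) ∈ M. -/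
open TensorProduct

/-- Let `f : (A, δ_A) → (B, δ_B)` be a differential ring homomorphism
(here `f = algebraMap A B`), `(N, d_N)` a differential `B`-module, `d₁` the induced
additive map on `N ⊗[A] B` and `d₂` on `B ⊗[A] N`.  If `φ : N ⊗[A] B → B ⊗[A] N` is a
differential additive isomorphism (`φ ∘ d₁ = d₂ ∘ φ`), then the `A`-submodule
`M = {x ∈ N : φ (x ⊗ 1) = 1 ⊗ x}` is closed under `d_N`. -/
theorem descended_submodule_closed_under_derivation
    {A B N : Type*} [CommRing A] [CommRing B] [Algebra A B]
    [AddCommGroup N] [Module B N] [Module A N] [IsScalarTower A B N]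
    (δA : A → A)
    (hδAadd : ∀ a b : A, δA (a + b) = δA a + δA b)
    (hδAmul : ∀ a b : A, δA (a * b) = δA a * b + a * δA b)
    (δB : B → B)
    (hδBadd : ∀ x y : B, δB (x + y) = δB x + δB y)
    (hδBmul : ∀ x y : B, δB (x * y) = δB x * y + x * δB y)
    (hcompat : ∀ a : A, δB (algebraMap A B a) = algebraMap A B (δA a))
    (dN : N → N)
    (hdNadd : ∀ x y : N, dN (x + y) = dN x + dN y)
    (hdNsmul : ∀ (b : B) (x : N), dN (b • x) = δB b • x + b • dN x)
    (d₁ : N ⊗[A] B → N ⊗[A] B)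
    (hd₁add : ∀ s t : N ⊗[A] B, d₁ (s + t) = d₁ s + d₁ t)
    (hd₁ : ∀ (x : N) (b : B), d₁ (x ⊗ₜ[A] b) = dN x ⊗ₜ[A] b + x ⊗ₜ[A] δB b)
    (d₂ : B ⊗[A] N → B ⊗[A] N)
    (hd₂add : ∀ s t : B ⊗[A] N, d₂ (s + t) = d₂ s + d₂ t)
    (hd₂ : ∀ (b : B) (x : N), d₂ (b ⊗ₜ[A] x) = δB b ⊗ₜ[A] x + b ⊗ₜ[A] dN x)
    (φ : N ⊗[A] B ≃+ B ⊗[A] N)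
    (hφ : ∀ t : N ⊗[A] B, φ (d₁ t) = d₂ (φ t)) :
    ∀ x : N, φ (x ⊗ₜ[A] (1 : B)) = (1 : B) ⊗ₜ[A] x →
      φ (dN x ⊗ₜ[A] (1 : B)) = (1 : B) ⊗ₜ[A] dN x := by
  intro x hx
  have hone : δB 1 = 0 := by simpa using hδBmul 1 1
  have h := hφ (x ⊗ₜ[A] (1 : B))
  rw [hx, hd₁, hd₂, hone, tmul_zero, zero_tmul, add_zero, zero_add] at h
  exact h
end
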